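/- Let k be a field, R a k-algebra, and N ≥ 1 an integer. If (𝓐, 𝓑) is a hereditary cotorsion pair in the category of left R-modules, then (Φ(𝓐), Φ(𝓐)^⊥) and (⊥Ψ(𝓑), Ψ(𝓑)) are hereditary, compatible cotorsion pairs in the category 𝓧 of N-periodic chain complexes of left R-modules, where Φ(𝓐) = {X ∈ 𝓧 | for every q ∈ ℤ/N, Coker(∂_q^X) ∈ 𝓐 and H_q(X) = 0} and Ψ(𝓑) = {X ∈ 𝓧 | for every q ∈ ℤ/N, Ker(∂_q^X) ∈ 𝓑 and H_q(X) = 0}. -/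

import Mathlib

/-!
Statement 14 (Theorem B(i) in Holm–Jørgensen, "Model categories of quiver representations").

Let `k` be a field, `R` a `k`-algebra and `N ≥ 1`.  If `(𝓐, 𝓑)` is a hereditary cotorsion
pair in the category of left `R`-modules, then `(Φ(𝓐), Φ(𝓐)^⊥)` and `(⊥Ψ(𝓑), Ψ(𝓑))` are
hereditary, compatible cotorsion pairs in the category `𝓧` of `N`-periodic chain complexes
of left `R`-modules, where
`Φ(𝓐) = {X | ∀ q, Coker(∂_q^X) ∈ 𝓐 and H_q(X) = 0}` and
`Ψ(𝓑) = {X | ∀ q, Ker(∂_q^X) ∈ 𝓑 and H_q(X) = 0}`.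
-/

open CategoryTheory CategoryTheory.Limits CategoryTheory.Abelian

universe w w' v u

section Defs

variable {𝓨 : Type u} [Category.{v} 𝓨] [Abelian 𝓨] [HasExt.{w} 𝓨]

/-- `Γ^⊥ = {Y | Ext¹(C, Y) = 0 for all C ∈ Γ}`. -/
def rightPerp (Γ : Set 𝓨) : Set 𝓨 :=
  {Y | ∀ C ∈ Γ, Subsingleton (Ext C Y 1)}

/-- `⊥Δ = {Y | Ext¹(Y, D) = 0 for all D ∈ Δ}`. -/
def leftPerp (Δ : Set 𝓨) : Set 𝓨 :=
  {Y | ∀ D ∈ Δ, Subsingleton (Ext Y D 1)}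

/-- `(Γ, Δ)` is a cotorsion pair if `Γ = ⊥Δ` and `Γ^⊥ = Δ`. -/
def IsCotorsionPair (Γ Δ : Set 𝓨) : Prop :=
  Γ = leftPerp Δ ∧ rightPerp Γ = Δ

/-- `Γ` is closed under kernels of epimorphisms. -/
def ClosedUnderKernelsOfEpis (Γ : Set 𝓨) : Prop :=
  ∀ ⦃X Y : 𝓨⦄ (f : X ⟶ Y), Epi f → X ∈ Γ → Y ∈ Γ → (kernel f : 𝓨) ∈ Γ

/-- `Δ` is closed under cokernels of monomorphisms. -/
def ClosedUnderCokernelsOfMonos (Δ : Set 𝓨) : Prop :=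
  ∀ ⦃X Y : 𝓨⦄ (f : X ⟶ Y), Mono f → X ∈ Δ → Y ∈ Δ → (cokernel f : 𝓨) ∈ Δ

/-- A cotorsion pair `(Γ, Δ)` is hereditary if `Γ` is closed under kernels of
epimorphisms and `Δ` is closed under cokernels of monomorphisms. -/
def IsHereditary (Γ Δ : Set 𝓨) : Prop :=
  ClosedUnderKernelsOfEpis Γ ∧ ClosedUnderCokernelsOfMonos Δ

end Defs

/-- The category of `N`-periodic chain complexes of left `R`-modules: complexes indexed by
`ℤ/N` with differentials `∂_q : X_q → X_{q-1}` squaring to zero. -/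
abbrev PeriodicComplexes (R : Type u) [Ring R] (N : ℕ) :=
  HomologicalComplex (ModuleCat.{u} R) (ComplexShape.down (ZMod N))

variable (R : Type u) [Ring R] (N : ℕ)

/-- `Φ(𝓐) = {X | ∀ q, Coker(∂_q^X) ∈ 𝓐 and H_q(X) = 0}`. -/
noncomputable def PhiPeriodic (𝓐 : Set (ModuleCat.{u} R)) : Set (PeriodicComplexes R N) :=
  {X | ∀ q : ZMod N, (cokernel (X.d q (q - 1)) : ModuleCat.{u} R) ∈ 𝓐 ∧
    IsZero (X.homology q)}

/-- `Ψ(𝓑) = {X | ∀ q, Ker(∂_q^X) ∈ 𝓑 and H_q(X) = 0}`. -/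
noncomputable def PsiPeriodic (𝓑 : Set (ModuleCat.{u} R)) : Set (PeriodicComplexes R N) :=
  {X | ∀ q : ZMod N, (kernel (X.d q (q - 1)) : ModuleCat.{u} R) ∈ 𝓑 ∧
    IsZero (X.homology q)}


section

variable {C : Type u} [Category.{v} C] [Abelian C]

lemma shortExact_kernel {X Y : C} (f : X ⟶ Y) [Epi f] :
    (ShortComplex.mk _ _ (kernel.condition f)).ShortExact where
  exact := ShortComplex.exact_of_f_is_kernel _ (kernelIsKernel f)

lemma shortExact_cokernel {X Y : C} (f : X ⟶ Y) [Mono f] :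
    (ShortComplex.mk _ _ (cokernel.condition f)).ShortExact where
  exact := ShortComplex.exact_of_g_is_cokernel _ (cokernelIsCokernel f)

end

section ExtLemmas

variable {C : Type u} [Category.{v} C] [Abelian C] [HasExt.{w} C]

lemma exists_lift_of_subsingleton_ext {S : ShortComplex C} (hS : S.ShortExact) {X : C}
    (hX : Subsingleton (Ext X S.X₁ 1)) (f : X ⟶ S.X₃) : ∃ g : X ⟶ S.X₂, g ≫ S.g = f := by
  obtain ⟨x, hx⟩ := Ext.covariant_sequence_exact₃ X hS (Ext.mk₀ f) rfl (Subsingleton.elim _ _)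
  obtain ⟨g, rfl⟩ := Ext.addEquiv₀.symm.surjective x
  exact ⟨g, Ext.addEquiv₀.symm.injective (by simpa using hx)⟩

lemma exists_desc_of_subsingleton_ext {S : ShortComplex C} (hS : S.ShortExact) {Y : C}
    (hY : Subsingleton (Ext S.X₃ Y 1)) (f : S.X₁ ⟶ Y) : ∃ g : S.X₂ ⟶ Y, S.f ≫ g = f := by
  obtain ⟨x, hx⟩ := Ext.contravariant_sequence_exact₁ hS Y (Ext.mk₀ f) rfl (Subsingleton.elim _ _)
  obtain ⟨g, rfl⟩ := Ext.addEquiv₀.symm.surjective x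
  exact ⟨g, Ext.addEquiv₀.symm.injective (by simpa using hx)⟩

lemma subsingleton_ext_middle {S : ShortComplex C} (hS : S.ShortExact) {X : C} {n : ℕ}
    (h₁ : Subsingleton (Ext X S.X₁ n)) (h₃ : Subsingleton (Ext X S.X₃ n)) :
    Subsingleton (Ext X S.X₂ n) := by
  refine subsingleton_of_forall_eq 0 fun e ↦ ?_
  obtain ⟨x, rfl⟩ := Ext.covariant_sequence_exact₂ X hS e (Subsingleton.elim _ _)
  rw [Subsingleton.elim x 0, Ext.zero_comp]

lemma subsingleton_ext_left_of_lift {S : ShortComplex C} (hS : S.ShortExact) {X : C}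
    (h₂ : Subsingleton (Ext X S.X₂ 1)) (h : ∀ f : X ⟶ S.X₃, ∃ g : X ⟶ S.X₂, g ≫ S.g = f) :
    Subsingleton (Ext X S.X₁ 1) := by
  refine subsingleton_of_forall_eq 0 fun e ↦ ?_
  obtain ⟨x, rfl⟩ := Ext.covariant_sequence_exact₁ X hS e (Subsingleton.elim _ _) (zero_add 1)
  obtain ⟨f, rfl⟩ := Ext.addEquiv₀.symm.surjective x
  obtain ⟨g, rfl⟩ := h f
  simp [← Ext.mk₀_comp_mk₀]

lemma subsingleton_ext_right_of_desc {S : ShortComplex C} (hS : S.ShortExact) {Y : C}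
    (h₂ : Subsingleton (Ext S.X₂ Y 1)) (h : ∀ f : S.X₁ ⟶ Y, ∃ g : S.X₂ ⟶ Y, S.f ≫ g = f) :
    Subsingleton (Ext S.X₃ Y 1) := by
  refine subsingleton_of_forall_eq 0 fun e ↦ ?_
  obtain ⟨x, rfl⟩ := Ext.contravariant_sequence_exact₃ hS Y e (Subsingleton.elim _ _) (add_zero 1)
  obtain ⟨f, rfl⟩ := Ext.addEquiv₀.symm.surjective x
  obtain ⟨g, rfl⟩ := h f
  simp [← Ext.mk₀_comp_mk₀]

lemma subsingleton_ext_left {S : ShortComplex C} (hS : S.ShortExact) {X : C} {n : ℕ}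
    (h₃ : Subsingleton (Ext X S.X₃ n)) (h₂ : Subsingleton (Ext X S.X₂ (n + 1))) :
    Subsingleton (Ext X S.X₁ (n + 1)) := by
  refine subsingleton_of_forall_eq 0 fun e ↦ ?_
  obtain ⟨x, rfl⟩ := Ext.covariant_sequence_exact₁ X hS e (Subsingleton.elim _ _) rfl
  rw [Subsingleton.elim x 0, Ext.zero_comp]

lemma subsingleton_ext_right {S : ShortComplex C} (hS : S.ShortExact) {X : C} {n : ℕ}
    (h₂ : Subsingleton (Ext X S.X₂ n)) (h₁ : Subsingleton (Ext X S.X₁ (n + 1))) :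
    Subsingleton (Ext X S.X₃ n) := by
  refine subsingleton_of_forall_eq 0 fun e ↦ ?_
  obtain ⟨x, rfl⟩ := Ext.covariant_sequence_exact₃ X hS e rfl (Subsingleton.elim _ _)
  rw [Subsingleton.elim x 0, Ext.zero_comp]

lemma subsingleton_ext_source_right {S : ShortComplex C} (hS : S.ShortExact) {Y : C} {n : ℕ}
    (h₁ : Subsingleton (Ext S.X₁ Y n)) (h₂ : Subsingleton (Ext S.X₂ Y (n + 1))) :
    Subsingleton (Ext S.X₃ Y (n + 1)) := by
  refine subsingleton_of_forall_eq 0 fun e ↦ ?_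
  obtain ⟨x, rfl⟩ := Ext.contravariant_sequence_exact₃ hS Y e (Subsingleton.elim _ _)
    (add_comm 1 n)
  rw [Subsingleton.elim x 0, Ext.comp_zero]

lemma subsingleton_ext_source_left {S : ShortComplex C} (hS : S.ShortExact) {Y : C} {n : ℕ}
    (h₂ : Subsingleton (Ext S.X₂ Y n)) (h₃ : Subsingleton (Ext S.X₃ Y (n + 1))) :
    Subsingleton (Ext S.X₁ Y n) := by
  refine subsingleton_of_forall_eq 0 fun e ↦ ?_
  obtain ⟨x, rfl⟩ := Ext.contravariant_sequence_exact₁ hS Y e (add_comm 1 n)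
    (Subsingleton.elim _ _)
  rw [Subsingleton.elim x 0, Ext.comp_zero]

lemma subsingleton_ext_of_retract_left {X X' Y : C} {n : ℕ} (r : Retract X X')
    (h : Subsingleton (Ext X' Y n)) : Subsingleton (Ext X Y n) := by
  refine subsingleton_of_forall_eq 0 fun e ↦ ?_
  rw [← Ext.mk₀_id_comp e, ← r.retract, ← Ext.mk₀_comp_mk₀, Ext.comp_assoc_of_second_deg_zero,
    Subsingleton.elim ((Ext.mk₀ r.r).comp e (zero_add n)) 0, Ext.comp_zero]

lemma subsingleton_ext_of_retract_right {X Y Y' : C} {n : ℕ} (r : Retract Y Y')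
    (h : Subsingleton (Ext X Y' n)) : Subsingleton (Ext X Y n) := by
  refine subsingleton_of_forall_eq 0 fun e ↦ ?_
  rw [← Ext.comp_mk₀_id e, ← r.retract, ← Ext.mk₀_comp_mk₀, ← Ext.comp_assoc_of_second_deg_zero,
    Subsingleton.elim (e.comp (Ext.mk₀ r.i) (add_zero n)) 0, Ext.zero_comp]

lemma mem_rightPerp_of_retract {Γ : Set C} {Y Y' : C} (r : Retract Y Y')
    (h : Y' ∈ rightPerp Γ) : Y ∈ rightPerp Γ :=
  fun D hD ↦ subsingleton_ext_of_retract_right r (h D hD)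

lemma mem_leftPerp_of_retract {Δ : Set C} {X X' : C} (r : Retract X X')
    (h : X' ∈ leftPerp Δ) : X ∈ leftPerp Δ :=
  fun D hD ↦ subsingleton_ext_of_retract_left r (h D hD)

lemma mem_rightPerp_of_injective (Γ : Set C) (I : C) [Injective I] : I ∈ rightPerp Γ :=
  fun X _ ↦ Ext.subsingleton_of_injective X I 0

lemma mem_leftPerp_of_projective (Δ : Set C) (P : C) [Projective P] : P ∈ leftPerp Δ :=
  fun Y _ ↦ Ext.subsingleton_of_projective P Y 0

lemma isCotorsionPair_of_eq_leftPerp {Γ Δ : Set C} (h : Γ = leftPerp Δ) :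
    IsCotorsionPair Γ (rightPerp Γ) := by
  refine ⟨Set.Subset.antisymm (fun X hX Y hY ↦ hY X hX) fun X hX ↦ ?_, rfl⟩
  rw [h]
  exact fun D hD ↦ hX D fun Z hZ ↦ (h ▸ hZ : Z ∈ leftPerp Δ) D hD

lemma isCotorsionPair_of_eq_rightPerp {Γ Δ : Set C} (h : Δ = rightPerp Γ) :
    IsCotorsionPair (leftPerp Δ) Δ := by
  refine ⟨rfl, Set.Subset.antisymm (fun X hX ↦ ?_) fun Y hY X hX ↦ hX Y hY⟩
  rw [h]
  exact fun D hD ↦ hX D fun Z hZ ↦ (h ▸ hZ : Z ∈ rightPerp Γ) D hD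

lemma IsCotorsionPair.closedUnderCokernelsOfMonos [EnoughProjectives C] {Γ Δ : Set C}
    (h : IsCotorsionPair Γ Δ) (hΓ : ClosedUnderKernelsOfEpis Γ) :
    ClosedUnderCokernelsOfMonos Δ := by
  intro Y Z f _ hY hZ
  rw [← h.2] at hY hZ ⊢
  intro X hX
  refine subsingleton_ext_right (shortExact_cokernel f) (hZ X hX) ?_
  refine subsingleton_ext_source_right (shortExact_kernel (Projective.π X)) (hY _ ?_)
    (Ext.subsingleton_of_projective _ _ 1)
  exact hΓ _ inferInstance (h.1 ▸ mem_leftPerp_of_projective Δ _) hX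

lemma IsCotorsionPair.closedUnderKernelsOfEpis [EnoughInjectives C] {Γ Δ : Set C}
    (h : IsCotorsionPair Γ Δ) (hΔ : ClosedUnderCokernelsOfMonos Δ) :
    ClosedUnderKernelsOfEpis Γ := by
  intro X Z f _ hX hZ
  rw [h.1] at hX hZ ⊢
  intro Y hY
  refine subsingleton_ext_source_left (shortExact_kernel f) (hX Y hY) ?_
  refine subsingleton_ext_left (shortExact_cokernel (Injective.ι Y)) (hZ _ ?_)
    (Ext.subsingleton_of_injective _ _ 1)
  exact hΔ _ inferInstance hY (h.2 ▸ mem_rightPerp_of_injective Γ _)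

/-- `Ext¹(X, Y)` vanishes as soon as every extension of `X` by `Y` splits. -/
lemma subsingleton_ext_one_of_forall_split [EnoughInjectives C] {X Y : C}
    (h : ∀ ⦃E : C⦄ (i : Y ⟶ E) (p : E ⟶ X) (w : i ≫ p = 0),
      (ShortComplex.mk i p w).ShortExact → ∃ r : E ⟶ Y, i ≫ r = 𝟙 Y) :
    Subsingleton (Ext X Y 1) := by
  refine subsingleton_ext_left_of_lift (shortExact_cokernel (Injective.ι Y))
    (Ext.subsingleton_of_injective _ _ 0) ?_
  dsimp
  set ι := Injective.ι Y
  set π := cokernel.π ι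
  intro φ
  let i : Y ⟶ pullback π φ := pullback.lift ι 0 (by simp [π])
  have hi : i ≫ pullback.fst π φ = ι := pullback.lift_fst _ _ _
  have w : i ≫ pullback.snd π φ = 0 := pullback.lift_snd _ _ _
  have : Mono i := mono_of_mono_fac hi
  have hS : (ShortComplex.mk i (pullback.snd π φ) w).ShortExact :=
    { exact := by
        refine ShortComplex.exact_of_f_is_kernel _ (KernelFork.IsLimit.ofι' _ _ fun k hk ↦ ?_)
        have hk' : (k ≫ pullback.fst π φ) ≫ π = 0 := by
          rw [Category.assoc, pullback.condition, reassoc_of% hk, zero_comp]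
        obtain ⟨l, hl⟩ := KernelFork.IsLimit.lift' (shortExact_cokernel ι).fIsKernel _ hk'
        refine ⟨l, pullback.hom_ext ?_ ?_⟩
        · simpa [hi] using hl
        · simpa [w] using hk.symm }
  obtain ⟨r, hr⟩ := h _ _ _ hS
  obtain ⟨g, hg⟩ := CokernelCofork.IsColimit.desc' hS.gIsCokernel (pullback.fst π φ - r ≫ ι)
    (by simp [hi, reassoc_of% hr])
  refine ⟨g, ?_⟩
  dsimp at hg
  rw [← cancel_epi (pullback.snd π φ), reassoc_of% hg]
  simp [π, pullback.condition]

end ExtLemmas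

section Complexes

variable {C : Type u} [Category.{v} C] [Abelian C] {N : ℕ}

lemma ComplexShape.down_zmod_rel (q : ZMod N) : (ComplexShape.down (ZMod N)).Rel q (q - 1) :=
  sub_add_cancel q 1

lemma ComplexShape.down_zmod_rel' (q : ZMod N) : (ComplexShape.down (ZMod N)).Rel (q + 1) q := rfl

lemma ComplexShape.down_zmod_next (q : ZMod N) : (ComplexShape.down (ZMod N)).next q = q - 1 :=
  ComplexShape.next_eq' _ (ComplexShape.down_zmod_rel q)

lemma ComplexShape.down_zmod_prev (q : ZMod N) : (ComplexShape.down (ZMod N)).prev q = q + 1 :=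
  ComplexShape.prev_eq' _ (ComplexShape.down_zmod_rel' q)

/-- The complex with terms `M q` and zero differentials. -/
abbrev sphereComplex (M : ZMod N → C) : HomologicalComplex C (ComplexShape.down (ZMod N)) where
  X := M
  d _ _ := 0

/-- The morphism of complexes with zero differentials given by a family of morphisms. -/
@[simps]
def sphereComplexMap {M M' : ZMod N → C} (f : ∀ q, M q ⟶ M' q) :
    sphereComplex M ⟶ sphereComplex M' where
  f := f

lemma shortExact_sphereComplex (S : ZMod N → ShortComplex C) (hS : ∀ q, (S q).ShortExact) :
    (ShortComplex.mk (sphereComplexMap fun q ↦ (S q).f) (sphereComplexMap fun q ↦ (S q).g)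
      (by ext; simp)).ShortExact :=
  HomologicalComplex.shortExact_of_degreewise_shortExact _ hS

variable (N) in
/-- The contractible complex with all terms `M ⊞ M`, whose differential maps the first summand
identically to the second one. -/
noncomputable abbrev discComplex (M : C) : HomologicalComplex C (ComplexShape.down (ZMod N)) where
  X _ := M ⊞ M
  d i j := if (ComplexShape.down (ZMod N)).Rel i j then biprod.fst ≫ biprod.inr else 0
  shape _ _ h := if_neg h
  d_comp_d' i j k hij hjk := by rw [if_pos hij, if_pos hjk]; simp

lemma discComplex_d_of_rel (M : C) {i j : ZMod N} (h : (ComplexShape.down (ZMod N)).Rel i j) :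
    (discComplex N M).d i j = biprod.fst ≫ biprod.inr :=
  if_pos h

/-- Functoriality of `discComplex`. -/
@[simps]
noncomputable def discComplexMap {M M' : C} (f : M ⟶ M') :
    discComplex N M ⟶ discComplex N M' where
  f _ := biprod.map f f
  comm' i j h := by
    rw [discComplex_d_of_rel _ h, discComplex_d_of_rel _ h]
    simp

/-- The morphism from `discComplex N M` given by a family of morphisms from `M`. -/
@[simps]
noncomputable def discDesc {M : C} {X : HomologicalComplex C (ComplexShape.down (ZMod N))}
    (f : ∀ q, M ⟶ X.X q) : discComplex N M ⟶ X where
  f q := biprod.desc (f q) (f (q + 1) ≫ X.d (q + 1) q)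
  comm' i j h := by
    obtain rfl : j + 1 = i := h
    rw [discComplex_d_of_rel _ rfl]
    ext <;> simp

/-- The morphism to `discComplex N M` given by a family of morphisms to `M`. -/
@[simps]
noncomputable def discLift {M : C} {X : HomologicalComplex C (ComplexShape.down (ZMod N))}
    (g : ∀ q, X.X q ⟶ M) : X ⟶ discComplex N M where
  f q := biprod.lift (X.d q (q - 1) ≫ g (q - 1)) (g q)
  comm' i j h := by
    obtain rfl : j = i - 1 := eq_sub_of_add_eq h
    rw [discComplex_d_of_rel _ h]
    ext <;> simp

lemma discComplex_inr_comp {M : C} {X : HomologicalComplex C (ComplexShape.down (ZMod N))}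
    (φ : discComplex N M ⟶ X) (q : ZMod N) :
    (biprod.inr : M ⟶ M ⊞ M) ≫ φ.f q =
      (biprod.inl : M ⟶ M ⊞ M) ≫ φ.f (q + 1) ≫ X.d (q + 1) q := by
  rw [φ.comm, discComplex_d_of_rel M rfl]
  simp

lemma comp_discComplex_fst {M : C} {X : HomologicalComplex C (ComplexShape.down (ZMod N))}
    (φ : X ⟶ discComplex N M) (q : ZMod N) :
    φ.f q ≫ (biprod.fst : M ⊞ M ⟶ M) =
      X.d q (q - 1) ≫ φ.f (q - 1) ≫ (biprod.snd : M ⊞ M ⟶ M) := by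
  rw [← φ.comm_assoc, discComplex_d_of_rel M (ComplexShape.down_zmod_rel q)]
  simp

lemma discComplex_hom_ext {M : C} {X : HomologicalComplex C (ComplexShape.down (ZMod N))}
    {φ ψ : discComplex N M ⟶ X}
    (h : ∀ q, (biprod.inl : M ⟶ M ⊞ M) ≫ φ.f q = (biprod.inl : M ⟶ M ⊞ M) ≫ ψ.f q) : φ = ψ := by
  ext q : 1
  apply biprod.hom_ext'
  · exact h q
  · rw [discComplex_inr_comp, discComplex_inr_comp, reassoc_of% h (q + 1)]

lemma hom_discComplex_ext {M : C} {X : HomologicalComplex C (ComplexShape.down (ZMod N))}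
    {φ ψ : X ⟶ discComplex N M}
    (h : ∀ q, φ.f q ≫ (biprod.snd : M ⊞ M ⟶ M) = ψ.f q ≫ (biprod.snd : M ⊞ M ⟶ M)) : φ = ψ := by
  ext q : 1
  apply biprod.hom_ext
  · rw [comp_discComplex_fst, comp_discComplex_fst, h (q - 1)]
  · exact h q

instance (P : C) [Projective P] : Projective (discComplex N P) where
  factors {E X} f e _ :=
    ⟨discDesc fun q ↦ Projective.factorThru ((biprod.inl : P ⟶ P ⊞ P) ≫ f.f q) (e.f q),
      discComplex_hom_ext fun q ↦ by simp⟩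

instance (I : C) [Injective I] : Injective (discComplex N I) where
  factors {X Y} g f _ :=
    ⟨discLift fun q ↦ Injective.factorThru (g.f q ≫ (biprod.snd : I ⊞ I ⟶ I)) (f.f q),
      hom_discComplex_ext fun q ↦ by simp⟩

instance [NeZero N] [EnoughProjectives C] :
    EnoughProjectives (HomologicalComplex C (ComplexShape.down (ZMod N))) where
  presentation X := by
    have := Abelian.hasFiniteBiproducts (C := C)
    let f : Projective.over (⨁ X.X) ⟶ ⨁ X.X := Projective.π _
    have (q : ZMod N) : Epi ((discDesc fun q ↦ f ≫ biproduct.π X.X q).f q) := by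
      have h : biprod.inl ≫ (discDesc fun q ↦ f ≫ biproduct.π X.X q).f q =
          f ≫ biproduct.π X.X q := by simp
      exact epi_of_epi_fac h
    exact ⟨{ p := _, f := _, epi := HomologicalComplex.epi_of_epi_f _ this }⟩

instance [NeZero N] [EnoughInjectives C] :
    EnoughInjectives (HomologicalComplex C (ComplexShape.down (ZMod N))) where
  presentation X := by
    have := Abelian.hasFiniteBiproducts (C := C)
    let f : ⨁ X.X ⟶ Injective.under (⨁ X.X) := Injective.ι _
    have (q : ZMod N) : Mono ((discLift fun q ↦ biproduct.ι X.X q ≫ f).f q) := by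
      have h : (discLift fun q ↦ biproduct.ι X.X q ≫ f).f q ≫ biprod.snd =
          biproduct.ι X.X q ≫ f := by simp
      exact mono_of_mono_fac h
    exact ⟨{ J := _, f := _, mono := HomologicalComplex.mono_of_mono_f _ this }⟩

lemma biprod_map_comp_biprod_map_eq_zero (S : ShortComplex C) :
    biprod.map S.f S.f ≫ biprod.map S.g S.g = 0 := by
  ext <;> simp

lemma shortExact_biprod_map {S : ShortComplex C} (hS : S.ShortExact) :
    (ShortComplex.mk _ _ (biprod_map_comp_biprod_map_eq_zero S)).ShortExact := by
  have := hS.mono_f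
  have := hS.epi_g
  refine ShortComplex.ShortExact.mk (ShortComplex.exact_of_f_is_kernel _
    (KernelFork.IsLimit.ofι' _ _ fun k hk ↦ ?_))
  obtain ⟨l₁, h₁⟩ := KernelFork.IsLimit.lift' hS.fIsKernel (k ≫ biprod.fst) (by
    simpa using hk =≫ biprod.fst)
  obtain ⟨l₂, h₂⟩ := KernelFork.IsLimit.lift' hS.fIsKernel (k ≫ biprod.snd) (by
    simpa using hk =≫ biprod.snd)
  dsimp at h₁ h₂
  exact ⟨biprod.lift l₁ l₂, by ext <;> simp [h₁, h₂]⟩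

lemma shortExact_discComplex {S : ShortComplex C} (hS : S.ShortExact) :
    (ShortComplex.mk (discComplexMap (N := N) S.f) (discComplexMap S.g)
      (by ext : 1; exact biprod_map_comp_biprod_map_eq_zero S)).ShortExact :=
  HomologicalComplex.shortExact_of_degreewise_shortExact _ fun _ ↦ shortExact_biprod_map hS

variable (N) in
/-- The complex `discComplex N M` as an extension of complexes with zero differentials. -/
noncomputable abbrev sphereDiscSphere (M : C) :
    ShortComplex (HomologicalComplex C (ComplexShape.down (ZMod N))) where
  X₁ := sphereComplex fun _ ↦ M
  X₂ := discComplex N M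
  X₃ := sphereComplex fun _ ↦ M
  f := { f := fun _ ↦ biprod.inr, comm' := fun i j h ↦ by rw [discComplex_d_of_rel _ h]; simp }
  g := { f := fun _ ↦ biprod.fst, comm' := fun i j h ↦ by rw [discComplex_d_of_rel _ h]; simp }
  zero := by ext; simp

lemma shortExact_sphereDiscSphere (M : C) : (sphereDiscSphere N M).ShortExact :=
  HomologicalComplex.shortExact_of_degreewise_shortExact _ fun _ ↦
    ShortComplex.Splitting.shortExact
      (S := ShortComplex.mk (biprod.inr : M ⟶ M ⊞ M) biprod.fst (by simp))
      { r := biprod.snd, s := biprod.inl, f_r := by simp, s_g := by simp,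
        id := by simp [add_comm] }

end Complexes

section Spheres

open HomologicalComplex

variable {C : Type u} [Category.{v} C] [Abelian C] {N : ℕ}

/-- The morphism to a complex with zero differentials given by morphisms from the `opcycles`. -/
@[simps]
noncomputable def toSphereComplex {X : HomologicalComplex C (ComplexShape.down (ZMod N))}
    {M : ZMod N → C} (f : ∀ q, X.opcycles q ⟶ M q) : X ⟶ sphereComplex M where
  f q := X.pOpcycles q ≫ f q

/-- The morphism from a complex with zero differentials given by morphisms to the `cycles`. -/
@[simps]
noncomputable def fromSphereComplex {X : HomologicalComplex C (ComplexShape.down (ZMod N))}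
    {M : ZMod N → C} (f : ∀ q, M q ⟶ X.cycles q) : sphereComplex M ⟶ X where
  f q := f q ≫ X.iCycles q

instance (M : ZMod N → C) (q : ZMod N) : IsIso ((sphereComplex M).pOpcycles q) :=
  isIso_pOpcycles _ (q + 1) q (ComplexShape.down_zmod_prev q) rfl

instance (M : ZMod N → C) (q : ZMod N) : IsIso ((sphereComplex M).iCycles q) :=
  isIso_iCycles _ q (q - 1) (ComplexShape.down_zmod_next q) rfl

instance (M : ZMod N → C) (q : ZMod N) : IsIso ((sphereComplex M).homologyι q) :=
  isIso_homologyι _ q (q - 1) (ComplexShape.down_zmod_next q) rfl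

instance (M : ZMod N → C) (q : ZMod N) : IsIso ((sphereComplex M).homologyπ q) :=
  isIso_homologyπ _ (q + 1) q (ComplexShape.down_zmod_prev q) rfl

lemma shortExact_opcyclesMap {M : ZMod N → C}
    {E X : HomologicalComplex C (ComplexShape.down (ZMod N))} (hX : X.Acyclic)
    {i : sphereComplex M ⟶ E} {p : E ⟶ X} {w : i ≫ p = 0}
    (hS : (ShortComplex.mk i p w).ShortExact) (q : ZMod N) :
    (ShortComplex.mk (opcyclesMap i q) (opcyclesMap p q)
      (by rw [← opcyclesMap_comp, w, opcyclesMap_zero])).ShortExact := by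
  have := hS.epi_g
  have : Epi p := this
  have h : Mono (homologyMap i q) :=
    (hS.homology_exact₁ (q + 1) q rfl).mono_g
      ((hX (q + 1)).isZero_homology.eq_of_src _ _)
  have : Mono (opcyclesMap i q) := by
    have h' : opcyclesMap i q =
        inv ((sphereComplex M).homologyι q) ≫ homologyMap i q ≫ E.homologyι q := by simp
    rw [h']
    infer_instance
  exact { exact := opcycles_right_exact _ hS.exact q }

lemma shortExact_cyclesMap {M : ZMod N → C}
    {X E : HomologicalComplex C (ComplexShape.down (ZMod N))} (hX : X.Acyclic)
    {i : X ⟶ E} {p : E ⟶ sphereComplex M} {w : i ≫ p = 0}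
    (hS : (ShortComplex.mk i p w).ShortExact) (q : ZMod N) :
    (ShortComplex.mk (cyclesMap i q) (cyclesMap p q)
      (by rw [← cyclesMap_comp, w, cyclesMap_zero])).ShortExact := by
  have := hS.mono_f
  have : Mono i := this
  have h : Epi (homologyMap p q) :=
    (hS.homology_exact₃ q (q - 1) (ComplexShape.down_zmod_rel q)).epi_f
      ((hX (q - 1)).isZero_homology.eq_of_tgt _ _)
  have : Epi (cyclesMap p q) := by
    have h' : cyclesMap p q =
        E.homologyπ q ≫ homologyMap p q ≫ inv ((sphereComplex M).homologyπ q) := by simp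
    rw [h']
    infer_instance
  exact { exact := cycles_left_exact _ hS.exact q }

variable [HasExt.{w'} (HomologicalComplex C (ComplexShape.down (ZMod N)))]

lemma acyclic_of_subsingleton_ext_sphereComplex [EnoughInjectives C]
    {X : HomologicalComplex C (ComplexShape.down (ZMod N))}
    (h : ∀ (I : C) [Injective I],
      Subsingleton (Ext X (sphereComplex fun _ : ZMod N ↦ I) 1)) : X.Acyclic := by
  intro q
  obtain ⟨φ, hφ⟩ := exists_lift_of_subsingleton_ext
    (shortExact_sphereDiscSphere (N := N) (Injective.under (X.opcycles q)))
    (h _) (toSphereComplex (Pi.single q (Injective.ι (X.opcycles q))))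
  have hq : φ.f q ≫ biprod.fst = X.pOpcycles q ≫
      (Pi.single q (Injective.ι (X.opcycles q)) : ∀ p, X.opcycles p ⟶ _) q :=
    HomologicalComplex.congr_hom hφ q
  rw [Pi.single_eq_same, comp_discComplex_fst] at hq
  rw [exactAt_iff, ShortComplex.exact_iff_iCycles_pOpcycles_zero]
  change X.iCycles q ≫ X.pOpcycles q = 0
  rw [← cancel_mono (Injective.ι (X.opcycles q)), Category.assoc, ← hq, iCycles_d_assoc,
    zero_comp, zero_comp]

lemma acyclic_of_subsingleton_ext_of_sphereComplex [EnoughProjectives C]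
    {X : HomologicalComplex C (ComplexShape.down (ZMod N))}
    (h : ∀ (P : C) [Projective P],
      Subsingleton (Ext (sphereComplex fun _ : ZMod N ↦ P) X 1)) : X.Acyclic := by
  intro q
  obtain ⟨φ, hφ⟩ := exists_desc_of_subsingleton_ext
    (shortExact_sphereDiscSphere (N := N) (Projective.over (X.cycles q)))
    (h _) (fromSphereComplex (Pi.single q (Projective.π (X.cycles q))))
  have hq : biprod.inr ≫ φ.f q =
      (Pi.single q (Projective.π (X.cycles q)) : ∀ p, _ ⟶ X.cycles p) q ≫ X.iCycles q :=
    HomologicalComplex.congr_hom hφ q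
  rw [Pi.single_eq_same, discComplex_inr_comp] at hq
  rw [exactAt_iff, ShortComplex.exact_iff_iCycles_pOpcycles_zero]
  change X.iCycles q ≫ X.pOpcycles q = 0
  rw [← cancel_epi (Projective.π (X.cycles q)), ← Category.assoc, ← hq, Category.assoc,
    Category.assoc, d_pOpcycles, comp_zero, comp_zero, comp_zero]

variable [HasExt.{w} C]

lemma subsingleton_ext_sphereComplex [EnoughInjectives C] [NeZero N]
    {X : HomologicalComplex C (ComplexShape.down (ZMod N))} (hX : X.Acyclic) {M : ZMod N → C}
    (h : ∀ q, Subsingleton (Ext (X.opcycles q) (M q) 1)) :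
    Subsingleton (Ext X (sphereComplex M) 1) := by
  refine subsingleton_ext_one_of_forall_split fun E i p w hS ↦ ?_
  choose g hg using fun q ↦ exists_desc_of_subsingleton_ext (shortExact_opcyclesMap hX hS q)
    (h q) (inv ((sphereComplex M).pOpcycles q))
  refine ⟨toSphereComplex g, ?_⟩
  ext q : 1
  change i.f q ≫ E.pOpcycles q ≫ g q = 𝟙 _
  have hq : opcyclesMap i q ≫ g q = inv ((sphereComplex M).pOpcycles q) := hg q
  rw [← p_opcyclesMap_assoc, hq, IsIso.hom_inv_id]

lemma subsingleton_ext_of_sphereComplex [EnoughInjectives C] [NeZero N]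
    {X : HomologicalComplex C (ComplexShape.down (ZMod N))} (hX : X.Acyclic) {M : ZMod N → C}
    (h : ∀ q, Subsingleton (Ext (M q) (X.cycles q) 1)) :
    Subsingleton (Ext (sphereComplex M) X 1) := by
  refine subsingleton_ext_one_of_forall_split fun E i p w hS ↦ ?_
  choose g hg using fun q ↦ exists_lift_of_subsingleton_ext (shortExact_cyclesMap hX hS q)
    (h q) (inv ((sphereComplex M).iCycles q))
  have := hS.mono_f
  have hs : fromSphereComplex g ≫ p = 𝟙 _ := by
    ext q : 1
    change (g q ≫ E.iCycles q) ≫ p.f q = 𝟙 _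
    have hq : g q ≫ cyclesMap p q = inv ((sphereComplex M).iCycles q) := hg q
    rw [Category.assoc, ← cyclesMap_i, reassoc_of% hq, IsIso.inv_hom_id]
  exact ⟨_, (ShortComplex.Splitting.ofExactOfSection _ hS.exact _ hs this).f_r⟩

lemma subsingleton_ext_opcycles [EnoughInjectives C]
    {X : HomologicalComplex C (ComplexShape.down (ZMod N))} {B : C}
    (h : Subsingleton (Ext X (sphereComplex fun _ : ZMod N ↦ B) 1)) (q : ZMod N) :
    Subsingleton (Ext (X.opcycles q) B 1) := by
  refine subsingleton_ext_left_of_lift (shortExact_cokernel (Injective.ι B))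
    (Ext.subsingleton_of_injective _ _ 0) fun f ↦ ?_
  obtain ⟨φ, hφ⟩ := exists_lift_of_subsingleton_ext
    (shortExact_sphereComplex (fun _ : ZMod N ↦ _) fun _ ↦ shortExact_cokernel (Injective.ι B))
    h (toSphereComplex (Pi.single q f))
  have hq : φ.f q ≫ cokernel.π (Injective.ι B) =
      X.pOpcycles q ≫ (Pi.single q f : ∀ p, X.opcycles p ⟶ _) q :=
    HomologicalComplex.congr_hom hφ q
  rw [Pi.single_eq_same] at hq
  refine ⟨X.descOpcycles (φ.f q) (q + 1) (ComplexShape.down_zmod_prev q) ?_, ?_⟩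
  · rw [← φ.comm]
    exact comp_zero
  · rw [← cancel_epi (X.pOpcycles q), ← hq, p_descOpcycles_assoc]

lemma subsingleton_ext_cycles [EnoughProjectives C]
    {X : HomologicalComplex C (ComplexShape.down (ZMod N))} {A : C}
    (h : Subsingleton (Ext (sphereComplex fun _ : ZMod N ↦ A) X 1)) (q : ZMod N) :
    Subsingleton (Ext A (X.cycles q) 1) := by
  refine subsingleton_ext_right_of_desc (shortExact_kernel (Projective.π A))
    (Ext.subsingleton_of_projective _ _ 0) fun f ↦ ?_
  obtain ⟨φ, hφ⟩ := exists_desc_of_subsingleton_ext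
    (shortExact_sphereComplex (fun _ : ZMod N ↦ _) fun _ ↦ shortExact_kernel (Projective.π A))
    h (fromSphereComplex (Pi.single q f))
  have hq : kernel.ι (Projective.π A) ≫ φ.f q =
      (Pi.single q f : ∀ p, _ ⟶ X.cycles p) q ≫ X.iCycles q :=
    HomologicalComplex.congr_hom hφ q
  rw [Pi.single_eq_same] at hq
  refine ⟨X.liftCycles (φ.f q) (q - 1) (ComplexShape.down_zmod_next q) ?_, ?_⟩
  · rw [φ.comm]
    exact zero_comp
  · rw [← cancel_mono (X.iCycles q), ← hq, Category.assoc, liftCycles_i]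

end Spheres

section CotorsionPairs

open HomologicalComplex

variable {C : Type u} [Category.{v} C] [Abelian C] {N : ℕ}

variable (N) in
/-- The acyclic complexes all of whose `opcycles` lie in `𝓐`. -/
def acyclicOpcycles (𝓐 : Set C) : Set (HomologicalComplex C (ComplexShape.down (ZMod N))) :=
  {X | X.Acyclic ∧ ∀ q, X.opcycles q ∈ 𝓐}

variable (N) in
/-- The acyclic complexes all of whose `cycles` lie in `𝓑`. -/
def acyclicCycles (𝓑 : Set C) : Set (HomologicalComplex C (ComplexShape.down (ZMod N))) :=
  {X | X.Acyclic ∧ ∀ q, X.cycles q ∈ 𝓑}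

/-- An acyclic complex as an extension of complexes with zero differentials. -/
lemma exists_shortExact_sphereComplex_cycles
    {X : HomologicalComplex C (ComplexShape.down (ZMod N))} (hX : X.Acyclic) :
    ∃ (i : (sphereComplex fun q ↦ X.cycles q) ⟶ X)
      (p : X ⟶ sphereComplex fun q ↦ X.cycles (q - 1)) (w : i ≫ p = 0),
        (ShortComplex.mk i p w).ShortExact := by
  refine ⟨{ f := fun q ↦ X.iCycles q }, { f := fun q ↦ X.toCycles q (q - 1), comm' := ?_ },
    ?_, ?_⟩
  · intro i j h
    rw [comp_zero]
    obtain rfl : j + 1 = i := h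
    exact (X.d_toCycles (j + 1) j (j - 1)).symm
  · ext q : 1
    exact (cancel_mono (X.iCycles (q - 1))).1 (by simp)
  · refine HomologicalComplex.shortExact_of_degreewise_shortExact _ fun q ↦ ?_
    have : Epi (X.toCycles q (q - 1)) := Preadditive.epi_of_isZero_cokernel' _
      (X.homologyIsCokernel q (q - 1) (ComplexShape.prev_eq' _ (ComplexShape.down_zmod_rel q)))
      (hX (q - 1)).isZero_homology
    have hS : (ShortComplex.mk (X.iCycles q) (X.toCycles q (q - 1))
        ((cancel_mono (X.iCycles (q - 1))).1 (by simp))).ShortExact :=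
      ShortComplex.ShortExact.mk (ShortComplex.exact_of_f_is_kernel _
        (KernelFork.IsLimit.ofι' _ _ fun k hk ↦ ⟨X.liftCycles k (q - 1)
          (ComplexShape.down_zmod_next q) (by simpa using hk =≫ X.iCycles (q - 1)), by simp⟩))
    exact hS

variable [HasExt.{w'} (HomologicalComplex C (ComplexShape.down (ZMod N)))]

lemma subsingleton_ext_two_sphereComplex [EnoughInjectives C] [NeZero N]
    {X : HomologicalComplex C (ComplexShape.down (ZMod N))} {S : ShortComplex C}
    (hS : S.ShortExact) [Injective S.X₂]
    (h₂ : Subsingleton (Ext X (sphereComplex fun _ : ZMod N ↦ S.X₂) 1))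
    (h₃ : Subsingleton (Ext X (sphereComplex fun _ : ZMod N ↦ S.X₃) 1)) :
    Subsingleton (Ext X (sphereComplex fun _ : ZMod N ↦ S.X₁) 2) :=
  subsingleton_ext_left (shortExact_sphereComplex (fun _ : ZMod N ↦ S) fun _ ↦ hS) h₃
    (subsingleton_ext_left (shortExact_sphereDiscSphere S.X₂) h₂
      (Ext.subsingleton_of_injective _ _ 1))

lemma subsingleton_ext_two_of_sphereComplex [EnoughProjectives C] [NeZero N]
    {X : HomologicalComplex C (ComplexShape.down (ZMod N))} {S : ShortComplex C}
    (hS : S.ShortExact) [Projective S.X₂]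
    (h₁ : Subsingleton (Ext (sphereComplex fun _ : ZMod N ↦ S.X₁) X 1))
    (h₂ : Subsingleton (Ext (sphereComplex fun _ : ZMod N ↦ S.X₂) X 1)) :
    Subsingleton (Ext (sphereComplex fun _ : ZMod N ↦ S.X₃) X 2) :=
  subsingleton_ext_source_right (shortExact_sphereComplex (fun _ : ZMod N ↦ S) fun _ ↦ hS) h₁
    (subsingleton_ext_source_right (shortExact_sphereDiscSphere S.X₂) h₂
      (Ext.subsingleton_of_projective _ _ 1))

variable [HasExt.{w} C] [NeZero N] {𝓐 𝓑 : Set C}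

lemma IsCotorsionPair.acyclicOpcycles_eq_leftPerp [EnoughInjectives C]
    (h : IsCotorsionPair 𝓐 𝓑) :
    acyclicOpcycles N 𝓐 = leftPerp ((fun B ↦ sphereComplex fun _ : ZMod N ↦ B) '' 𝓑) := by
  ext X
  constructor
  · rintro ⟨hX, hq⟩ _ ⟨B, hB, rfl⟩
    exact subsingleton_ext_sphereComplex hX fun q ↦ (h.1 ▸ hq q : _ ∈ leftPerp 𝓑) B hB
  · intro hX
    refine ⟨acyclic_of_subsingleton_ext_sphereComplex fun I _ ↦
      hX _ ⟨I, h.2 ▸ mem_rightPerp_of_injective 𝓐 I, rfl⟩, fun q ↦ ?_⟩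
    rw [h.1]
    exact fun B hB ↦ subsingleton_ext_opcycles (hX _ ⟨B, hB, rfl⟩) q

lemma IsCotorsionPair.acyclicCycles_eq_rightPerp [EnoughInjectives C] [EnoughProjectives C]
    (h : IsCotorsionPair 𝓐 𝓑) :
    acyclicCycles N 𝓑 = rightPerp ((fun A ↦ sphereComplex fun _ : ZMod N ↦ A) '' 𝓐) := by
  ext X
  constructor
  · rintro ⟨hX, hq⟩ _ ⟨A, hA, rfl⟩
    exact subsingleton_ext_of_sphereComplex hX fun q ↦ (h.2 ▸ hq q : _ ∈ rightPerp 𝓐) A hA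
  · intro hX
    refine ⟨acyclic_of_subsingleton_ext_of_sphereComplex fun P _ ↦
      hX _ ⟨P, h.1 ▸ mem_leftPerp_of_projective 𝓑 P, rfl⟩, fun q ↦ ?_⟩
    rw [← h.2]
    exact fun A hA ↦ subsingleton_ext_cycles (hX _ ⟨A, hA, rfl⟩) q

lemma IsCotorsionPair.closedUnderKernelsOfEpis_acyclicOpcycles [EnoughInjectives C]
    (h : IsCotorsionPair 𝓐 𝓑) (h𝓑 : ClosedUnderCokernelsOfMonos 𝓑) :
    ClosedUnderKernelsOfEpis (acyclicOpcycles N 𝓐) := by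
  rw [h.acyclicOpcycles_eq_leftPerp]
  rintro X Y f _ hX hY _ ⟨B, hB, rfl⟩
  have hI : Injective.under B ∈ 𝓑 := h.2 ▸ mem_rightPerp_of_injective 𝓐 _
  have : Injective (ShortComplex.mk _ _ (cokernel.condition (Injective.ι B))).X₂ :=
    inferInstanceAs (Injective (Injective.under B))
  exact subsingleton_ext_source_left (shortExact_kernel f) (hX _ ⟨B, hB, rfl⟩)
    (subsingleton_ext_two_sphereComplex (shortExact_cokernel (Injective.ι B))
      (hY _ ⟨_, hI, rfl⟩) (hY _ ⟨_, h𝓑 _ inferInstance hB hI, rfl⟩))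

lemma IsCotorsionPair.closedUnderCokernelsOfMonos_acyclicCycles [EnoughInjectives C]
    [EnoughProjectives C] (h : IsCotorsionPair 𝓐 𝓑) (h𝓐 : ClosedUnderKernelsOfEpis 𝓐) :
    ClosedUnderCokernelsOfMonos (acyclicCycles N 𝓑) := by
  rw [h.acyclicCycles_eq_rightPerp]
  rintro X Y f _ hX hY _ ⟨A, hA, rfl⟩
  have hP : Projective.over A ∈ 𝓐 := h.1 ▸ mem_leftPerp_of_projective 𝓑 _
  have : Projective (ShortComplex.mk _ _ (kernel.condition (Projective.π A))).X₂ :=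
    inferInstanceAs (Projective (Projective.over A))
  exact subsingleton_ext_right (shortExact_cokernel f) (hY _ ⟨A, hA, rfl⟩)
    (subsingleton_ext_two_of_sphereComplex (shortExact_kernel (Projective.π A))
      (hX _ ⟨_, h𝓐 _ inferInstance hP hA, rfl⟩) (hX _ ⟨_, hP, rfl⟩))

lemma IsCotorsionPair.subsingleton_ext_acyclic [EnoughInjectives C] (h : IsCotorsionPair 𝓐 𝓑)
    {X Y : HomologicalComplex C (ComplexShape.down (ZMod N))}
    (hX : X ∈ acyclicOpcycles N 𝓐) (hY : Y ∈ acyclicCycles N 𝓑) :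
    Subsingleton (Ext X Y 1) := by
  obtain ⟨i, p, w, hS⟩ := exists_shortExact_sphereComplex_cycles hY.1
  exact subsingleton_ext_middle hS
    (subsingleton_ext_sphereComplex hX.1 fun q ↦ (h.1 ▸ hX.2 q : _ ∈ leftPerp 𝓑) _ (hY.2 q))
    (subsingleton_ext_sphereComplex hX.1 fun q ↦ (h.1 ▸ hX.2 q : _ ∈ leftPerp 𝓑) _ (hY.2 _))

end CotorsionPairs

section Shift

open HomologicalComplex

variable {C : Type u} [Category.{v} C] [Abelian C] {N : ℕ}

/-- The complex `X` shifted by `a`, with the opposite differential. -/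
abbrev shiftComplex (a : ZMod N) (X : HomologicalComplex C (ComplexShape.down (ZMod N))) :
    HomologicalComplex C (ComplexShape.down (ZMod N)) where
  X i := X.X (i + a)
  d i j := -X.d (i + a) (j + a)
  shape i j h := by
    rw [X.shape _ _ fun h' : j + a + 1 = i + a ↦ h (add_right_cancel (by rwa [add_right_comm])),
      neg_zero]

/-- Shifting by `1` and then by `-1` is isomorphic to the identity. -/
noncomputable def shiftComplexIso (X : HomologicalComplex C (ComplexShape.down (ZMod N))) :
    shiftComplex (-1) (shiftComplex 1 X) ≅ X :=
  Hom.isoOfComponents (fun i ↦ X.XIsoOfEq (neg_add_cancel_right i 1))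
    fun i j _ ↦ by simp

section

variable (a : ZMod N) (X : HomologicalComplex C (ComplexShape.down (ZMod N)))

lemma d_pOpcycles_shiftComplex (q : ZMod N) :
    X.d (q + 1 + a) (q + a) ≫ (shiftComplex a X).pOpcycles q = 0 := by
  have h := (shiftComplex a X).d_pOpcycles (q + 1) q
  dsimp only at h
  rwa [Preadditive.neg_comp, neg_eq_zero] at h

lemma iCycles_d_shiftComplex (q : ZMod N) :
    (shiftComplex a X).iCycles q ≫ X.d (q + a) (q - 1 + a) = 0 := by
  have h := (shiftComplex a X).iCycles_d q (q - 1)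
  dsimp only at h
  rwa [Preadditive.comp_neg, neg_eq_zero] at h

/-- The `cycles` of a shifted complex are a retract of those of the original complex. -/
noncomputable def cyclesShiftComplexRetract (q : ZMod N) :
    Retract ((shiftComplex a X).cycles q) (X.cycles (q + a)) where
  i := X.liftCycles ((shiftComplex a X).iCycles q) (q - 1 + a)
    (ComplexShape.next_eq' _ (show q - 1 + a + 1 = q + a by ring)) (iCycles_d_shiftComplex a X q)
  r := (shiftComplex a X).liftCycles (X.iCycles (q + a)) (q - 1)
    (ComplexShape.down_zmod_next q) (by simp)
  retract := by
    rw [← cancel_mono ((shiftComplex a X).iCycles q), Category.assoc, liftCycles_i, liftCycles_i,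
      Category.id_comp]

/-- The `opcycles` of a shifted complex are a retract of those of the original complex. -/
noncomputable def opcyclesShiftComplexRetract (q : ZMod N) :
    Retract ((shiftComplex a X).opcycles q) (X.opcycles (q + a)) where
  i := (shiftComplex a X).descOpcycles (X.pOpcycles (q + a)) (q + 1)
    (ComplexShape.down_zmod_prev q) (by simp)
  r := X.descOpcycles ((shiftComplex a X).pOpcycles q) (q + 1 + a)
    (ComplexShape.prev_eq' _ (add_right_comm q a 1)) (d_pOpcycles_shiftComplex a X q)
  retract := by
    rw [← cancel_epi ((shiftComplex a X).pOpcycles q), p_descOpcycles_assoc, p_descOpcycles,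
      Category.comp_id]

variable {X} in
lemma acyclic_shiftComplex (hX : X.Acyclic) : (shiftComplex a X).Acyclic := by
  intro q
  rw [exactAt_iff, ShortComplex.exact_iff_iCycles_pOpcycles_zero]
  change (shiftComplex a X).iCycles q ≫ (shiftComplex a X).pOpcycles q = 0
  have hq : X.iCycles (q + a) ≫ X.pOpcycles (q + a) = 0 :=
    (ShortComplex.exact_iff_iCycles_pOpcycles_zero _).1 (hX (q + a))
  rw [← X.liftCycles_i _ (q - 1 + a) (ComplexShape.next_eq' _
      (show q - 1 + a + 1 = q + a by ring)) (iCycles_d_shiftComplex a X q),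
    ← X.p_descOpcycles ((shiftComplex a X).pOpcycles q) (q + 1 + a)
      (ComplexShape.prev_eq' _ (add_right_comm q a 1)) (d_pOpcycles_shiftComplex a X q),
    Category.assoc, reassoc_of% hq, zero_comp, comp_zero]

end

variable {X : HomologicalComplex C (ComplexShape.down (ZMod N))}

lemma id_eq_of_homotopy (h : Homotopy (𝟙 X) 0) (q : ZMod N) :
    𝟙 (X.X q) = X.d q (q - 1) ≫ h.hom (q - 1) q + h.hom q (q + 1) ≫ X.d (q + 1) q := by
  have hq := h.comm q
  rw [dNext_eq _ (ComplexShape.down_zmod_rel q), prevD_eq _ (ComplexShape.down_zmod_rel' q)] at hq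
  simpa using hq

/-- In a contractible complex, the `cycles` are retracts of the terms. -/
noncomputable def cyclesRetractOfHomotopy (h : Homotopy (𝟙 X) 0) (q : ZMod N) :
    Retract (X.cycles q) (X.X (q + 1)) where
  i := X.iCycles q ≫ h.hom q (q + 1)
  r := X.toCycles (q + 1) q
  retract := by
    have hq := X.iCycles q ≫= id_eq_of_homotopy h q
    rw [← cancel_mono (X.iCycles q)]
    simpa using hq.symm

/-- In a contractible complex, the `opcycles` are retracts of the terms. -/
noncomputable def opcyclesRetractOfHomotopy (h : Homotopy (𝟙 X) 0) (q : ZMod N) :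
    Retract (X.opcycles q) (X.X (q - 1)) where
  i := X.fromOpcycles q (q - 1)
  r := h.hom (q - 1) q ≫ X.pOpcycles q
  retract := by
    have hq := id_eq_of_homotopy h q =≫ X.pOpcycles q
    rw [← cancel_epi (X.pOpcycles q)]
    simpa using hq.symm

/-- The complex `X` is contractible if every extension of its shift by `X` splits. -/
lemma nonempty_homotopy_of_subsingleton_ext
    [HasExt.{w'} (HomologicalComplex C (ComplexShape.down (ZMod N)))]
    (h : Subsingleton (Ext (shiftComplex (-1) X) X 1)) : Nonempty (Homotopy (𝟙 X) 0) := by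
  have rel (i : ZMod N) : (ComplexShape.down (ZMod N)).Rel i (i + -1) :=
    neg_add_cancel_right i 1
  let p : homotopyCofiber (𝟙 X) ⟶ shiftComplex (-1) X :=
    { f := fun i ↦ homotopyCofiber.fstX (𝟙 X) i (i + -1) (rel i)
      comm' := fun i j hij ↦ by
        obtain rfl : j = i + -1 := by rw [← (show j + 1 = i from hij), add_neg_cancel_right]
        exact (homotopyCofiber.d_fstX (𝟙 X) i (i + -1) _ hij (rel _)).symm ▸ by simp }
  have w : homotopyCofiber.inr (𝟙 X) ≫ p = 0 := by
    ext i : 1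
    exact homotopyCofiber.inrX_fstX (𝟙 X) i (i + -1) (rel i)
  have hS : (ShortComplex.mk _ _ w).ShortExact :=
    HomologicalComplex.shortExact_of_degreewise_shortExact _ fun i ↦
      ShortComplex.Splitting.shortExact
        (S := ShortComplex.mk (homotopyCofiber.inrX (𝟙 X) i)
          (homotopyCofiber.fstX (𝟙 X) i (i + -1) (rel i)) (by simp))
        { r := homotopyCofiber.sndX (𝟙 X) i
          s := homotopyCofiber.inlX (𝟙 X) (i + -1) i (rel i)
          f_r := by simp
          s_g := by simp
          id := by
            apply homotopyCofiber.ext_to_X (𝟙 X) i (i + -1) (rel i) <;> simp }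
  obtain ⟨r, hr⟩ := exists_desc_of_subsingleton_ext hS h (𝟙 X)
  dsimp at hr
  exact ⟨((Homotopy.ofEq (by simp [hr])).trans
    ((homotopyCofiber.inrCompHomotopy (𝟙 X) fun i ↦
      ⟨_, ComplexShape.down_zmod_rel' i⟩).compRight r)).trans
      (Homotopy.ofEq (by simp))⟩

end Shift

section Compatible

open HomologicalComplex

variable {C : Type u} [Category.{v} C] [Abelian C] {N : ℕ} [HasExt.{w} C]
  [HasExt.{w'} (HomologicalComplex C (ComplexShape.down (ZMod N)))]

lemma subsingleton_ext_of_discComplex_iff [EnoughProjectives C]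
    {X : HomologicalComplex C (ComplexShape.down (ZMod N))} {A : C} :
    Subsingleton (Ext (discComplex N A) X 1) ↔ ∀ q, Subsingleton (Ext A (X.X q) 1) := by
  have hA := shortExact_kernel (Projective.π A)
  constructor
  · intro h q
    refine subsingleton_ext_right_of_desc hA (Ext.subsingleton_of_projective _ _ 0) fun f ↦ ?_
    obtain ⟨φ, hφ⟩ := exists_desc_of_subsingleton_ext (shortExact_discComplex hA) h
      (discDesc (Pi.single q f))
    have hq : biprod.map (kernel.ι (Projective.π A)) (kernel.ι (Projective.π A)) ≫ φ.f q =
        biprod.desc ((Pi.single q f : ∀ p, _ ⟶ X.X p) q)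
          ((Pi.single q f : ∀ p, _ ⟶ X.X p) (q + 1) ≫ X.d (q + 1) q) :=
      HomologicalComplex.congr_hom hφ q
    refine ⟨(biprod.inl : Projective.over A ⟶ Projective.over A ⊞ Projective.over A) ≫ φ.f q, ?_⟩
    have hq' := (biprod.inl : kernel (Projective.π A) ⟶ _) ≫= hq
    rw [biprod.inl_map_assoc, biprod.inl_desc, Pi.single_eq_same] at hq'
    exact hq'
  · intro h
    refine subsingleton_ext_right_of_desc (shortExact_discComplex (N := N) hA)
      (Ext.subsingleton_of_projective (discComplex N (Projective.over A)) _ 0) fun f ↦ ?_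
    choose g hg using fun q ↦ exists_desc_of_subsingleton_ext hA (h q)
      ((biprod.inl : kernel (Projective.π A) ⟶ _) ≫ f.f q)
    refine ⟨discDesc g, discComplex_hom_ext fun q ↦ ?_⟩
    rw [← hg q]
    exact (biprod.inl_map_assoc _ _ _).trans (by simp)

lemma subsingleton_ext_discComplex_iff [EnoughInjectives C]
    {X : HomologicalComplex C (ComplexShape.down (ZMod N))} {B : C} :
    Subsingleton (Ext X (discComplex N B) 1) ↔ ∀ q, Subsingleton (Ext (X.X q) B 1) := by
  have hB := shortExact_cokernel (Injective.ι B)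
  constructor
  · intro h q
    refine subsingleton_ext_left_of_lift hB (Ext.subsingleton_of_injective _ _ 0) fun f ↦ ?_
    obtain ⟨φ, hφ⟩ := exists_lift_of_subsingleton_ext (shortExact_discComplex hB) h
      (discLift (Pi.single q f))
    have hq : φ.f q ≫ biprod.map (cokernel.π (Injective.ι B)) (cokernel.π (Injective.ι B)) =
        biprod.lift (X.d q (q - 1) ≫ (Pi.single q f : ∀ p, X.X p ⟶ _) (q - 1))
          ((Pi.single q f : ∀ p, X.X p ⟶ _) q) :=
      HomologicalComplex.congr_hom hφ q
    refine ⟨φ.f q ≫ (biprod.snd : Injective.under B ⊞ Injective.under B ⟶ _), ?_⟩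
    have hq' := hq =≫ (biprod.snd : _ ⟶ cokernel (Injective.ι B))
    rw [Category.assoc, biprod.map_snd, biprod.lift_snd, Pi.single_eq_same] at hq'
    exact (Category.assoc _ _ _).trans hq'
  · intro h
    refine subsingleton_ext_left_of_lift (shortExact_discComplex (N := N) hB)
      (Ext.subsingleton_of_injective _ (discComplex N (Injective.under B)) 0) fun f ↦ ?_
    choose g hg using fun q ↦ exists_lift_of_subsingleton_ext hB (h q)
      (f.f q ≫ (biprod.snd : _ ⟶ cokernel (Injective.ι B)))
    refine ⟨discLift g, hom_discComplex_ext fun q ↦ ?_⟩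
    rw [← hg q]
    refine (Category.assoc _ _ _).trans ((_ ≫= biprod.map_snd _ _).trans ?_)
    simp

variable [EnoughInjectives C] [EnoughProjectives C] [NeZero N] {𝓐 𝓑 : Set C}

lemma IsCotorsionPair.acyclicOpcycles_inter_rightPerp_subset (h : IsCotorsionPair 𝓐 𝓑) :
    acyclicOpcycles N 𝓐 ∩ rightPerp (acyclicOpcycles N 𝓐) ⊆ acyclicCycles N 𝓑 := by
  rintro X ⟨⟨hX, hq⟩, hX'⟩
  have hX𝓑 (q : ZMod N) : X.X q ∈ 𝓑 := by
    rw [← h.2]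
    intro A hA
    refine subsingleton_ext_of_discComplex_iff.1 (hX' (discComplex N A) ?_) q
    rw [h.acyclicOpcycles_eq_leftPerp]
    rintro _ ⟨B, hB, rfl⟩
    exact subsingleton_ext_of_discComplex_iff.2 fun _ ↦ (h.1 ▸ hA : A ∈ leftPerp 𝓑) B hB
  obtain ⟨H⟩ := nonempty_homotopy_of_subsingleton_ext (X := X) (hX' _
    ⟨acyclic_shiftComplex _ hX, fun q ↦ by
      have hq' := hq (q + -1)
      rw [h.1] at hq' ⊢
      exact mem_leftPerp_of_retract (opcyclesShiftComplexRetract _ X q) hq'⟩)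
  refine ⟨hX, fun q ↦ ?_⟩
  have hq' := hX𝓑 (q + 1)
  rw [← h.2] at hq' ⊢
  exact mem_rightPerp_of_retract (cyclesRetractOfHomotopy H q) hq'

lemma IsCotorsionPair.leftPerp_inter_acyclicCycles_subset (h : IsCotorsionPair 𝓐 𝓑) :
    leftPerp (acyclicCycles N 𝓑) ∩ acyclicCycles N 𝓑 ⊆ acyclicOpcycles N 𝓐 := by
  rintro X ⟨hX', ⟨hX, hq⟩⟩
  have hX𝓐 (q : ZMod N) : X.X q ∈ 𝓐 := by
    rw [h.1]
    intro B hB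
    refine subsingleton_ext_discComplex_iff.1 (hX' (discComplex N B) ?_) q
    rw [h.acyclicCycles_eq_rightPerp]
    rintro _ ⟨A, hA, rfl⟩
    exact subsingleton_ext_discComplex_iff.2 fun _ ↦ (h.1 ▸ hA : A ∈ leftPerp 𝓑) B hB
  have hY : shiftComplex 1 X ∈ acyclicCycles N 𝓑 := ⟨acyclic_shiftComplex _ hX, fun q ↦ by
    have hq' := hq (q + 1)
    rw [← h.2] at hq' ⊢
    exact mem_rightPerp_of_retract (cyclesShiftComplexRetract _ X q) hq'⟩
  obtain ⟨H⟩ := nonempty_homotopy_of_subsingleton_ext (X := shiftComplex 1 X)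
    (subsingleton_ext_of_retract_left (shiftComplexIso X).retract (hX' _ hY))
  refine ⟨hX, fun q ↦ ?_⟩
  have hq' := hX𝓐 (q + -1 - 1 + 1)
  rw [h.1] at hq' ⊢
  exact mem_leftPerp_of_retract
    ((((opcyclesFunctor C _ q).mapIso (shiftComplexIso X).symm).retract.trans
      (opcyclesShiftComplexRetract (-1) (shiftComplex 1 X) q)).trans
        (opcyclesRetractOfHomotopy H (q + -1))) hq'

end Compatible

section PeriodicComplexes

variable {R N}
open HomologicalComplex

lemma phiPeriodic_eq_acyclicOpcycles [HasExt.{w} (ModuleCat.{u} R)]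
    {𝓐 𝓑 : Set (ModuleCat.{u} R)} (h : 𝓐 = leftPerp 𝓑) :
    PhiPeriodic R N 𝓐 = acyclicOpcycles N 𝓐 := by
  ext X
  have e (q : ZMod N) : X.opcycles (q - 1) ≅ cokernel (X.d q (q - 1)) :=
    (X.opcyclesIsCokernel q (q - 1) (ComplexShape.prev_eq' _
      (ComplexShape.down_zmod_rel q))).coconePointUniqueUpToIso (colimit.isColimit _)
  constructor
  · refine fun hX ↦ ⟨fun q ↦ (X.exactAt_iff_isZero_homology q).2 (hX q).2, fun q ↦ ?_⟩
    obtain ⟨q, rfl⟩ : ∃ p, q = p - 1 := ⟨q + 1, (add_sub_cancel_right q 1).symm⟩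
    have hq := (hX q).1
    rw [h] at hq ⊢
    exact mem_leftPerp_of_retract (e q).retract hq
  · refine fun hX q ↦ ⟨?_, (hX.1 q).isZero_homology⟩
    have hq := hX.2 (q - 1)
    rw [h] at hq ⊢
    exact mem_leftPerp_of_retract (e q).symm.retract hq

lemma psiPeriodic_eq_acyclicCycles [HasExt.{w} (ModuleCat.{u} R)]
    {𝓐 𝓑 : Set (ModuleCat.{u} R)} (h : rightPerp 𝓐 = 𝓑) :
    PsiPeriodic R N 𝓑 = acyclicCycles N 𝓑 := by
  ext X
  have e (q : ZMod N) : X.cycles q ≅ kernel (X.d q (q - 1)) :=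
    (X.cyclesIsKernel q (q - 1) (ComplexShape.down_zmod_next q)).conePointUniqueUpToIso
      (limit.isLimit _)
  constructor
  · refine fun hX ↦ ⟨fun q ↦ (X.exactAt_iff_isZero_homology q).2 (hX q).2, fun q ↦ ?_⟩
    have hq := (hX q).1
    rw [← h] at hq ⊢
    exact mem_rightPerp_of_retract (e q).retract hq
  · refine fun hX q ↦ ⟨?_, (hX.1 q).isZero_homology⟩
    have hq := hX.2 q
    rw [← h] at hq ⊢
    exact mem_rightPerp_of_retract (e q).symm.retract hq

end PeriodicComplexes

theorem periodic_hereditary_compatible_cotorsionPairs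
    (k : Type u) [Field k] [Algebra k R] (hN : 1 ≤ N)
    [HasExt.{w} (ModuleCat.{u} R)] [HasExt.{w'} (PeriodicComplexes R N)]
    (𝓐 𝓑 : Set (ModuleCat.{u} R))
    (h : IsCotorsionPair 𝓐 𝓑) (hher : IsHereditary 𝓐 𝓑) :
    (IsCotorsionPair (PhiPeriodic R N 𝓐) (rightPerp (PhiPeriodic R N 𝓐)) ∧
      IsHereditary (PhiPeriodic R N 𝓐) (rightPerp (PhiPeriodic R N 𝓐))) ∧
    (IsCotorsionPair (leftPerp (PsiPeriodic R N 𝓑)) (PsiPeriodic R N 𝓑) ∧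
      IsHereditary (leftPerp (PsiPeriodic R N 𝓑)) (PsiPeriodic R N 𝓑)) ∧
    ((∀ F ∈ PhiPeriodic R N 𝓐, ∀ P ∈ PsiPeriodic R N 𝓑, Subsingleton (Ext F P 1)) ∧
      PhiPeriodic R N 𝓐 ∩ rightPerp (PhiPeriodic R N 𝓐) =
        leftPerp (PsiPeriodic R N 𝓑) ∩ PsiPeriodic R N 𝓑) := by
  have : NeZero N := ⟨Nat.one_le_iff_ne_zero.1 hN⟩
  rw [phiPeriodic_eq_acyclicOpcycles h.1, psiPeriodic_eq_acyclicCycles h.2]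
  have hΦ := isCotorsionPair_of_eq_leftPerp (h.acyclicOpcycles_eq_leftPerp (N := N))
  have hΨ := isCotorsionPair_of_eq_rightPerp (h.acyclicCycles_eq_rightPerp (N := N))
  have hΦ' := h.closedUnderKernelsOfEpis_acyclicOpcycles (N := N) hher.2
  have hΨ' := h.closedUnderCokernelsOfMonos_acyclicCycles (N := N) hher.1
  refine ⟨⟨hΦ, hΦ', hΦ.closedUnderCokernelsOfMonos hΦ'⟩,
    ⟨hΨ, hΨ.closedUnderKernelsOfEpis hΨ', hΨ'⟩,
    fun F hF P hP ↦ h.subsingleton_ext_acyclic hF hP, Set.Subset.antisymm ?_ ?_⟩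
  · exact fun X hX ↦ ⟨fun Y hY ↦ h.subsingleton_ext_acyclic hX.1 hY,
      h.acyclicOpcycles_inter_rightPerp_subset hX⟩
  · exact fun X hX ↦ ⟨h.leftPerp_inter_acyclicCycles_subset hX,
      fun Y hY ↦ h.subsingleton_ext_acyclic hY hX.2⟩
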